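/- Let V₁ℂ be the standard 2-dimensional complex representation of SU(2), regarded as a 4-dimensional real representation, and S^m_ℝ(ℂ²) the space of real-valued homogeneous polynomials of degree m on ℂ². Then S^m_ℝ(ℂ²) ⊗ ℂ ≅ ⊕_{p=0}^{⌊m/2⌋} (m−2p+1)·Vℂ_{m−2p} as complex SU(2)-representations, where Vℂ_r denotes the irreducible complex representation of dimension r+1. -/

import Mathlib

open Matrix

/-- The derivation action on the degree-`m` homogeneous real polynomials on `ℝⁿ`
(equivalently `S^m(ℝⁿ)`) induced by a linear map `L` on `ℝⁿ`, in the monomial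
basis indexed by `Sym (Fin n) m`. -/
def symMatAct (n m : ℕ) (L : Matrix (Fin n) (Fin n) ℝ) :
    Matrix (Sym (Fin n) m) (Sym (Fin n) m) ℝ :=
  Matrix.of fun ν μ => ∑ i : Fin n, ∑ j : Fin n,
    if i ∈ (μ : Multiset (Fin n)) ∧
        (ν : Multiset (Fin n)) = j ::ₘ ((μ : Multiset (Fin n)).erase i)
      then (((μ : Multiset (Fin n)).count i : ℕ) : ℝ) * L j i else 0

/-- Realifications (on `ℂ² ≅ ℝ⁴`, coordinates `(x₁, y₁, x₂, y₂)`) of the standard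
`su(2)` basis `e_k = -(i/2)σ_k`, which satisfies `[e₁,e₂]=e₃`, `[e₂,e₃]=e₁`,
`[e₃,e₁]=e₂`.  These generate the standard `2`-dimensional complex representation
`V₁ℂ` of `SU(2)` viewed as a real `4`-dimensional representation. -/
noncomputable def R1 : Matrix (Fin 4) (Fin 4) ℝ := !![0,0,0,1/2; 0,0,-1/2,0; 0,1/2,0,0; -1/2,0,0,0]
noncomputable def R2 : Matrix (Fin 4) (Fin 4) ℝ := !![0,0,-1/2,0; 0,0,0,-1/2; 1/2,0,0,0; 0,1/2,0,0]
noncomputable def R3 : Matrix (Fin 4) (Fin 4) ℝ := !![0,1/2,0,0; -1/2,0,0,0; 0,0,0,-1/2; 0,0,1/2,0]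

/-- The complexified action of `L` on `S^m_ℝ(ℂ²) ⊗ ℂ`. -/
noncomputable def symMatActC (m : ℕ) (L : Matrix (Fin 4) (Fin 4) ℝ) :
    Matrix (Sym (Fin 4) m) (Sym (Fin 4) m) ℂ :=
  (symMatAct 4 m L).map (Complex.ofReal)

/-- A triple of complex matrices satisfying the `su(2)` commutation relations,
i.e. a complex representation of `su(2)` (equivalently of `SU(2)`). -/
def IsSU2RepC {N : Type*} [Fintype N] [DecidableEq N] (X Y Z : Matrix N N ℂ) : Prop :=
  X * Y - Y * X = Z ∧ Y * Z - Z * Y = X ∧ Z * X - X * Z = Y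

/-- Irreducibility of a complex representation given by three matrices. -/
def IsIrredRepC {N : Type*} [Fintype N] [DecidableEq N] (X Y Z : Matrix N N ℂ) : Prop :=
  ∀ U : Submodule ℂ (N → ℂ), (∀ v ∈ U, X.mulVec v ∈ U) → (∀ v ∈ U, Y.mulVec v ∈ U) →
    (∀ v ∈ U, Z.mulVec v ∈ U) → U = ⊥ ∨ U = ⊤

namespace SU2Aux

/-- raising matrix -/
noncomputable def Em (r : ℕ) : Matrix (Fin (r + 1)) (Fin (r + 1)) ℂ :=
  Matrix.of fun k i => if (k : ℕ) + 1 = i then ((k : ℕ) + 1 : ℂ) * ((r : ℂ) - (k : ℕ)) else 0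

/-- lowering matrix -/
noncomputable def Fm (r : ℕ) : Matrix (Fin (r + 1)) (Fin (r + 1)) ℂ :=
  Matrix.of fun k i => if (k : ℕ) = (i : ℕ) + 1 then 1 else 0

/-- weight matrix -/
noncomputable def Hm (r : ℕ) : Matrix (Fin (r + 1)) (Fin (r + 1)) ℂ :=
  Matrix.diagonal fun k => (r : ℂ) - 2 * (k : ℕ)

/-- Extension by zero of a vector. -/
noncomputable def ext0 {r : ℕ} (v : Fin (r + 1) → ℂ) (k : ℕ) : ℂ :=
  if h : k < r + 1 then v ⟨k, h⟩ else 0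

lemma ext0_coe {r : ℕ} (v : Fin (r + 1) → ℂ) (k : Fin (r + 1)) : ext0 v k = v k := by
  simp only [ext0, k.2, dif_pos]

lemma ext0_big {r : ℕ} (v : Fin (r + 1) → ℂ) (k : ℕ) (h : r < k) : ext0 v k = 0 := by
  simp [ext0]; omega

lemma ext0_ext {r : ℕ} (v w : Fin (r + 1) → ℂ) (h : ∀ k, k ≤ r → ext0 v k = ext0 w k) : v = w := by
  funext k
  rw [← ext0_coe v, ← ext0_coe w, h _ (by omega)]

lemma ext0_sub {r : ℕ} (v w : Fin (r + 1) → ℂ) (k : ℕ) : ext0 (v - w) k = ext0 v k - ext0 w k := by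
  unfold ext0; split_ifs <;> simp

lemma Em_mulVec (r : ℕ) (v : Fin (r + 1) → ℂ) (k : ℕ) :
    ext0 ((Em r).mulVec v) k = ((k : ℂ) + 1) * ((r : ℂ) - k) * ext0 v (k + 1) := by
  by_cases hk : k < r + 1
  · by_cases hk' : k + 1 < r + 1
    · have : ∀ i : Fin (r + 1), (k + 1 = (i : ℕ)) ↔ (⟨k + 1, hk'⟩ = i) := by
        intro i; simp [Fin.ext_iff]
      simp [ext0, hk, Matrix.mulVec, dotProduct, Em, this]
      simp at hk'
      simp [hk']
    · have : ∀ i : Fin (r + 1), ¬ (k + 1 = (i : ℕ)) := by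
        intro i; omega
      rw [ext0_big v _ (by omega)]
      simp [ext0, hk, Matrix.mulVec, dotProduct, Em, this]
  · rw [ext0_big _ _ (by omega), ext0_big _ _ (by omega)]; simp

lemma Fm_mulVec (r : ℕ) (v : Fin (r + 1) → ℂ) (k : ℕ) (hk : k + 1 ≤ r) :
    ext0 ((Fm r).mulVec v) (k + 1) = ext0 v k := by
  have : ∀ i : Fin (r + 1), (k = (i : ℕ)) ↔ (⟨k, by omega⟩ = i) := by
    intro i; simp [Fin.ext_iff]
  have h1 : k < r + 1 := by omega
  have h2 : k < r := by omega
  simp [ext0, h1, h2, Matrix.mulVec, dotProduct, Fm, this]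

lemma Fm_mulVec_zero (r : ℕ) (v : Fin (r + 1) → ℂ) :
    ext0 ((Fm r).mulVec v) 0 = 0 := by
  simp [ext0, Matrix.mulVec, dotProduct, Fm]

lemma Hm_mulVec (r : ℕ) (v : Fin (r + 1) → ℂ) (k : ℕ) :
    ext0 ((Hm r).mulVec v) k = ((r : ℂ) - 2 * k) * ext0 v k := by
  unfold ext0
  split_ifs with h
  · simp [Hm, Matrix.mulVec_diagonal]
  · simp

lemma EF (r : ℕ) : Em r * Fm r - Fm r * Em r = Hm r := by
  apply Matrix.ext_of_mulVec_single
  intro i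
  generalize (Pi.single i 1 : Fin (r+1) → ℂ) = v
  apply ext0_ext
  intro k hk
  rw [Matrix.sub_mulVec, ext0_sub, ← Matrix.mulVec_mulVec, ← Matrix.mulVec_mulVec, Hm_mulVec,
    Em_mulVec]
  have h1 : ((k : ℂ) + 1) * ((r : ℂ) - k) * ext0 ((Fm r).mulVec v) (k + 1)
      = ((k : ℂ) + 1) * ((r : ℂ) - k) * ext0 v k := by
    rcases Nat.lt_or_ge k r with h | h
    · rw [Fm_mulVec _ _ _ h]
    · have : k = r := by omega
      subst this; simp
  rw [h1]
  rcases k with _ | k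
  · rw [Fm_mulVec_zero]; simp
  · rw [Fm_mulVec _ _ _ hk, Em_mulVec]; push_cast; ring

lemma HE (r : ℕ) : Hm r * Em r - Em r * Hm r = (2 : ℂ) • Em r := by
  apply Matrix.ext_of_mulVec_single
  intro i
  generalize (Pi.single i 1 : Fin (r+1) → ℂ) = v
  apply ext0_ext
  intro k hk
  rw [Matrix.sub_mulVec, ext0_sub, ← Matrix.mulVec_mulVec, ← Matrix.mulVec_mulVec, Hm_mulVec,
    Em_mulVec, Em_mulVec, Hm_mulVec]
  have : ext0 (((2:ℂ) • Em r).mulVec v) k = 2 * ext0 ((Em r).mulVec v) k := by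
    rw [Matrix.smul_mulVec]; unfold ext0; split_ifs <;> simp
  rw [this, Em_mulVec]; push_cast; ring

lemma HF (r : ℕ) : Hm r * Fm r - Fm r * Hm r = (-2 : ℂ) • Fm r := by
  apply Matrix.ext_of_mulVec_single
  intro i
  generalize (Pi.single i 1 : Fin (r+1) → ℂ) = v
  apply ext0_ext
  intro k hk
  rw [Matrix.sub_mulVec, ext0_sub, ← Matrix.mulVec_mulVec, ← Matrix.mulVec_mulVec, Hm_mulVec]
  have : ext0 (((-2:ℂ) • Fm r).mulVec v) k = -2 * ext0 ((Fm r).mulVec v) k := by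
    rw [Matrix.smul_mulVec]; unfold ext0; split_ifs <;> simp
  rw [this]
  rcases k with _ | k
  · rw [Fm_mulVec_zero, Fm_mulVec_zero]; simp
  · rw [Fm_mulVec _ _ _ hk, Fm_mulVec _ _ _ hk, Hm_mulVec]; push_cast; ring

noncomputable def Xm (r : ℕ) : Matrix (Fin (r + 1)) (Fin (r + 1)) ℂ :=
  (-(Complex.I / 2)) • (Em r + Fm r)
noncomputable def Ym (r : ℕ) : Matrix (Fin (r + 1)) (Fin (r + 1)) ℂ :=
  (1 / 2 : ℂ) • (Fm r - Em r)
noncomputable def Zm (r : ℕ) : Matrix (Fin (r + 1)) (Fin (r + 1)) ℂ :=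
  (-(Complex.I / 2)) • Hm r

lemma Em_eq (r : ℕ) : Em r = Complex.I • Xm r - Ym r := by
  have := Complex.I_mul_I
  unfold Xm Ym
  match_scalars <;> grind

lemma Fm_eq (r : ℕ) : Fm r = Complex.I • Xm r + Ym r := by
  have := Complex.I_mul_I
  unfold Xm Ym
  match_scalars <;> grind

lemma isRep (r : ℕ) : IsSU2RepC (Xm r) (Ym r) (Zm r) := by
  have h1 := EF r
  have h2 := HE r
  have h3 := HF r
  have hI := Complex.I_mul_I
  have hI2 := Complex.I_sq
  unfold Xm Ym Zm IsSU2RepC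
  simp only [Matrix.smul_mul, Matrix.mul_smul, smul_smul, mul_add, add_mul, mul_sub, sub_mul]
  refine ⟨?_, ?_, ?_⟩
  · rw [← h1]; match_scalars <;> grind
  · have e2 : Em r = (1/2 : ℂ) • (Hm r * Em r - Em r * Hm r) := by rw [h2]; module
    have e3 : Fm r = (-1/2 : ℂ) • (Hm r * Fm r - Fm r * Hm r) := by rw [h3]; module
    conv_rhs => rw [e2, e3]
    match_scalars <;> grind
  · have e2 : Em r = (1/2 : ℂ) • (Hm r * Em r - Em r * Hm r) := by rw [h2]; module
    have e3 : Fm r = (-1/2 : ℂ) • (Hm r * Fm r - Fm r * Hm r) := by rw [h3]; module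
    conv_rhs => rw [e2, e3]
    match_scalars <;> grind

lemma isIrred (r : ℕ) : IsIrredRepC (Xm r) (Ym r) (Zm r) := by
  intro U hX hY hZ
  have hE : ∀ v ∈ U, (Em r).mulVec v ∈ U := by
    intro v hv
    rw [Em_eq, Matrix.sub_mulVec, Matrix.smul_mulVec]
    exact U.sub_mem (U.smul_mem _ (hX v hv)) (hY v hv)
  have hF : ∀ v ∈ U, (Fm r).mulVec v ∈ U := by
    intro v hv
    rw [Fm_eq, Matrix.add_mulVec, Matrix.smul_mulVec]
    exact U.add_mem (U.smul_mem _ (hX v hv)) (hY v hv)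
  by_cases hU : U = ⊥
  · exact Or.inl hU
  right
  obtain ⟨v, hv, hv0⟩ := Submodule.exists_mem_ne_zero_of_ne_bot hU
  -- a nonzero vector killed by `E`
  have key : ∀ n : ℕ, ∀ v ∈ U, v ≠ 0 → (∀ k, n ≤ k → ext0 v k = 0) →
      ∃ w ∈ U, w ≠ 0 ∧ (Em r).mulVec w = 0 := by
    intro n
    induction n with
    | zero =>
      intro v _ hv0 h
      exact absurd (ext0_ext v 0 (fun k _ => by rw [h k (Nat.zero_le _)]; simp [ext0])) hv0
    | succ n ih =>
      intro v hv hv0 h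
      by_cases hz : (Em r).mulVec v = 0
      · exact ⟨v, hv, hv0, hz⟩
      · refine ih _ (hE v hv) hz ?_
        intro k hk
        rw [Em_mulVec, h (k + 1) (by omega)]; simp
  obtain ⟨w, hw, hw0, hEw⟩ := key (r + 1) v hv hv0 (fun k hk => ext0_big _ _ (by omega))
  have hwk : ∀ k, k + 1 ≤ r → ext0 w (k + 1) = 0 := by
    intro k hk
    have := Em_mulVec r w k
    rw [hEw] at this
    have h0 : ext0 (0 : Fin (r+1) → ℂ) k = 0 := by simp [ext0]
    rw [h0] at this
    have h1 : ((k : ℂ) + 1) ≠ 0 := by exact_mod_cast Nat.succ_ne_zero k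
    have h2 : ((r : ℂ) - k) ≠ 0 := by
      rw [sub_ne_zero]; exact_mod_cast (by omega : r ≠ k)
    simpa [h1, h2] using this.symm
  have hw00 : ext0 w 0 ≠ 0 := by
    intro h
    apply hw0
    apply ext0_ext
    intro k hk
    rcases k with _ | k
    · rw [h]; simp [ext0]
    · rw [hwk k hk]; simp [ext0]
  have hsingle : ∀ k, (hk : k < r + 1) → (Pi.single ⟨k, hk⟩ 1 : Fin (r + 1) → ℂ) ∈ U := by
    intro k
    induction k with
    | zero =>
      intro hk
      have : (Pi.single ⟨0, hk⟩ 1 : Fin (r + 1) → ℂ) = (ext0 w 0)⁻¹ • w := by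
        apply ext0_ext
        intro k hk'
        have hs : ext0 ((ext0 w 0)⁻¹ • w) k = (ext0 w 0)⁻¹ * ext0 w k := by
          unfold ext0; split_ifs <;> simp
        rw [hs]
        rcases k with _ | k
        · rw [inv_mul_cancel₀ hw00]; simp [ext0]
        · rw [hwk k hk']; simp [ext0, Pi.single_apply]
      rw [this]; exact U.smul_mem _ hw
    | succ k ih =>
      intro hk
      have := hF _ (ih (by omega))
      convert this using 1
      apply ext0_ext
      intro l hl
      rcases l with _ | l
      · rw [Fm_mulVec_zero]; simp [ext0, Pi.single_apply]
      · rw [Fm_mulVec _ _ _ hl]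
        have h1 : l < r := by omega
        have h2 : l < r + 1 := by omega
        simp [ext0, Pi.single_apply, h1, h2]
  rw [eq_top_iff]
  intro x _
  rw [pi_eq_sum_univ' x]
  exact U.sum_mem fun i _ => U.smul_mem _ (by
    have := hsingle i i.2
    convert this using 1)

end SU2Aux
set_option linter.unusedSimpArgs false

namespace SU2Aux
open MvPolynomial

abbrev Pol := MvPolynomial (Fin 4) ℂ

noncomputable def mono {m : ℕ} (μ : Sym (Fin 4) m) : Pol :=
  monomial (Multiset.toFinsupp (μ : Multiset (Fin 4))) 1

/-- vectors as polynomials -/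
noncomputable def Phi (m : ℕ) : (Sym (Fin 4) m → ℂ) →ₗ[ℂ] Pol :=
  Fintype.linearCombination ℂ (fun μ => mono μ)

lemma Phi_apply (m : ℕ) (v : Sym (Fin 4) m → ℂ) : Phi m v = ∑ μ, v μ • mono μ := rfl

lemma coeff_Phi (m : ℕ) (v : Sym (Fin 4) m → ℂ) (μ : Sym (Fin 4) m) :
    coeff (Multiset.toFinsupp (μ : Multiset (Fin 4))) (Phi m v) = v μ := by
  rw [Phi_apply, coeff_sum]
  rw [Finset.sum_eq_single μ]
  · simp [mono]
  · intro ν _ hν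
    have : ¬ ((ν : Multiset (Fin 4)) = μ) := fun h => hν (Subtype.ext h)
    simp [mono, coeff_monomial, this]
  · simp

lemma Phi_inj (m : ℕ) : Function.Injective (Phi m) := by
  intro v w h
  funext μ
  rw [← coeff_Phi m v, ← coeff_Phi m w, h]

lemma Phi_surj (m : ℕ) (f : Pol) (hf : f.IsHomogeneous m) : f ∈ LinearMap.range (Phi m) := by
  refine ⟨fun μ => coeff (Multiset.toFinsupp (μ : Multiset (Fin 4))) f, ?_⟩
  ext s
  by_cases hs : s.degree = m
  · let μ : Sym (Fin 4) m := ⟨Finsupp.toMultiset s, by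
      rw [Finsupp.card_toMultiset, ← hs]; rfl⟩
    have : s = Multiset.toFinsupp (μ : Multiset (Fin 4)) := by
      simp [μ]
    rw [this, coeff_Phi]
  · rw [hf.coeff_eq_zero hs, Phi_apply, coeff_sum]
    apply Finset.sum_eq_zero
    intro μ _
    rw [coeff_smul, mono, coeff_monomial, if_neg, smul_zero]
    intro h
    apply hs
    rw [← h]
    have := Multiset.toFinsupp_sum_eq (μ : Multiset (Fin 4))
    rw [Sym.card_coe] at this
    exact this

/-- derivation attached to a matrix -/
noncomputable def Der (L : Matrix (Fin 4) (Fin 4) ℝ) : Derivation ℂ Pol Pol :=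
  mkDerivation ℂ fun i => ∑ j, (L j i : ℂ) • X j

lemma symMatActC_apply (m : ℕ) (L : Matrix (Fin 4) (Fin 4) ℝ) (ν μ : Sym (Fin 4) m) :
    symMatActC m L ν μ = ∑ i : Fin 4, ∑ j : Fin 4,
      if i ∈ (μ : Multiset (Fin 4)) ∧
        (ν : Multiset (Fin 4)) = j ::ₘ ((μ : Multiset (Fin 4)).erase i)
      then (((μ : Multiset (Fin 4)).count i : ℕ) : ℂ) * (L j i : ℂ) else 0 := by
  unfold symMatActC symMatAct
  rw [Matrix.map_apply, Matrix.of_apply]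
  simp only [Complex.ofReal_sum]
  refine Finset.sum_congr rfl fun i _ => Finset.sum_congr rfl fun j _ => ?_
  split_ifs <;> simp

lemma mono_term (m : ℕ) (l : ℂ) (μ : Sym (Fin 4) m) (i j : Fin 4) :
    ∑ ν : Sym (Fin 4) m, (if i ∈ (μ : Multiset (Fin 4)) ∧
        (ν : Multiset (Fin 4)) = j ::ₘ ((μ : Multiset (Fin 4)).erase i)
      then (((μ : Multiset (Fin 4)).count i : ℕ) : ℂ) * l else 0) • mono ν =
    (monomial (Multiset.toFinsupp (μ : Multiset (Fin 4)) - Finsupp.single i 1)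
      ((Multiset.toFinsupp (μ : Multiset (Fin 4)) i : ℕ) : ℂ)) • (l • (X j : Pol)) := by
  by_cases hi : i ∈ (μ : Multiset (Fin 4))
  · have hc : Multiset.card (j ::ₘ ((μ : Multiset (Fin 4)).erase i)) = m := by
      rw [Multiset.card_cons, Multiset.card_erase_of_mem hi, Sym.card_coe]
      have : 0 < m := by
        have := Multiset.card_pos_iff_exists_mem.2 ⟨i, hi⟩
        rwa [Sym.card_coe] at this
      exact Nat.succ_pred_eq_of_pos this
    refine (Finset.sum_eq_single (⟨_, hc⟩ : Sym (Fin 4) m) ?_ ?_).trans ?_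
    · intro ν _ hν
      rw [if_neg]
      · simp
      · rintro ⟨_, h⟩; exact hν (Subtype.ext h)
    · intro h; exact (h (Finset.mem_univ (α := Sym (Fin 4) m) _)).elim
    · simp only [hi, Sym.coe_mk, and_self, if_true]
      have e : (Multiset.toFinsupp (j ::ₘ ((μ : Multiset (Fin 4)).erase i))) =
          (Multiset.toFinsupp (μ : Multiset (Fin 4)) - Finsupp.single i 1) + Finsupp.single j 1 := by
        ext k
        simp only [Multiset.toFinsupp_apply, Finsupp.add_apply, Finsupp.tsub_apply,
          Finsupp.single_apply, Multiset.count_cons]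
        by_cases hk : k = i
        · subst hk; simp [eq_comm]
        · rw [Multiset.count_erase_of_ne hk]; simp [eq_comm, hk, Ne.symm hk]
      have e' : mono (⟨_, hc⟩ : Sym (Fin 4) m) = monomial ((Multiset.toFinsupp (μ : Multiset (Fin 4)) - Finsupp.single i 1) + Finsupp.single j 1) 1 := by
        rw [← e]; rfl
      rw [e']
      simp [X, smul_monomial, monomial_mul]
  · have : (μ : Multiset (Fin 4)).count i = 0 := Multiset.count_eq_zero.2 hi
    simp [hi]

lemma mono_col (m : ℕ) (L : Matrix (Fin 4) (Fin 4) ℝ) (μ : Sym (Fin 4) m) :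
    ∑ ν, symMatActC m L ν μ • mono ν = Der L (mono μ) := by
  unfold Der
  rw [mono, mkDerivation_monomial, one_smul, Finsupp.sum_fintype _ _ (by simp)]
  simp only [symMatActC_apply, Finset.sum_smul]
  rw [Finset.sum_comm]
  refine Finset.sum_congr rfl fun i _ => ?_
  rw [Finset.sum_comm, Finset.smul_sum]
  exact Finset.sum_congr rfl fun j _ => mono_term m _ μ i j

lemma Phi_act (m : ℕ) (L : Matrix (Fin 4) (Fin 4) ℝ) (v : Sym (Fin 4) m → ℂ) :
    Phi m ((symMatActC m L).mulVec v) = Der L (Phi m v) := by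
  rw [Phi_apply, Phi_apply, map_sum]
  simp only [Matrix.mulVec, dotProduct, Finset.sum_smul]
  rw [Finset.sum_comm]
  refine Finset.sum_congr rfl fun μ _ => ?_
  rw [Derivation.map_smul, ← mono_col, Finset.smul_sum]
  refine Finset.sum_congr rfl fun ν _ => ?_
  rw [smul_smul, mul_comm]

/-- constant `i` -/
noncomputable def ci : Pol := C Complex.I
/-- constant `1/2` -/
noncomputable def ch : Pol := C (1/2)

lemma ci2 : ci ^ 2 = -1 := by
  rw [ci, ← map_pow, Complex.I_sq]; simp

lemma C2 : (C 2 : Pol) = 2 := map_ofNat C 2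

lemma ch2 : 2 * ch = 1 := by
  rw [ch, ← C2, ← C_mul]; norm_num

lemma D_ci (D : Derivation ℂ Pol Pol) : D ci = 0 := derivation_C _ _
lemma D_ch (D : Derivation ℂ Pol Pol) : D ch = 0 := derivation_C _ _

noncomputable def pa : Pol := X 0 - ci * X 1
noncomputable def pb : Pol := X 2 - ci * X 3
noncomputable def pc : Pol := X 2 + ci * X 3
noncomputable def pd : Pol := - (X 0 + ci * X 1)
noncomputable def pq : Pol := X 0 ^ 2 + X 1 ^ 2 + X 2 ^ 2 + X 3 ^ 2

noncomputable def DE : Derivation ℂ Pol Pol := Complex.I • Der R1 - Der R2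
noncomputable def DF : Derivation ℂ Pol Pol := Complex.I • Der R1 + Der R2
noncomputable def DH : Derivation ℂ Pol Pol := (2 * Complex.I) • Der R3
/-- the weight operator of the commuting `sl₂` -/
noncomputable def DK : Derivation ℂ Pol Pol :=
  mkDerivation ℂ ![-ci * X 1, ci * X 0, -ci * X 3, ci * X 2]

lemma DerX1 (i : Fin 4) :
    Der R1 (X i) = (![-ch * X 3, ch * X 2, -ch * X 1, ch * X 0] : Fin 4 → Pol) i := by
  unfold Der ch
  simp only [mkDerivation_X, Fin.sum_univ_four]
  fin_cases i <;> simp [R1, neg_div, MvPolynomial.smul_eq_C_mul]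

lemma DerX2 (i : Fin 4) :
    Der R2 (X i) = (![ch * X 2, ch * X 3, -ch * X 0, -ch * X 1] : Fin 4 → Pol) i := by
  unfold Der ch
  simp only [mkDerivation_X, Fin.sum_univ_four]
  fin_cases i <;> simp [R2, neg_div, MvPolynomial.smul_eq_C_mul]

lemma DerX3 (i : Fin 4) :
    Der R3 (X i) = (![-ch * X 1, ch * X 0, ch * X 3, -ch * X 2] : Fin 4 → Pol) i := by
  unfold Der ch
  simp only [mkDerivation_X, Fin.sum_univ_four]
  fin_cases i <;> simp [R3, neg_div, MvPolynomial.smul_eq_C_mul]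

lemma DKX (i : Fin 4) : DK (X i) =
    (![-ci * X 1, ci * X 0, -ci * X 3, ci * X 2] : Fin 4 → Pol) i :=
  mkDerivation_X _ _ _

lemma DEX (i : Fin 4) : DE (X i) =
    (![ch * (-pc), ch * (ci * pc), ch * pa, ch * (ci * pa)] : Fin 4 → Pol) i := by
  have := ci2
  have e : ∀ x : Pol, Complex.I • x = ci * x := fun x => MvPolynomial.smul_eq_C_mul _ _
  unfold DE
  simp only [Derivation.sub_apply, Derivation.smul_apply, DerX1, DerX2, pa, pc, e]
  fin_cases i <;> simp <;> grind

/-- F: a→b, c→d, b→0, d→0 -/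
lemma DFX (i : Fin 4) : DF (X i) =
    (![ch * pb, ch * (ci * pb), ch * pd, ch * (-(ci * pd))] : Fin 4 → Pol) i := by
  have := ci2
  have e : ∀ x : Pol, Complex.I • x = ci * x := fun x => MvPolynomial.smul_eq_C_mul _ _
  unfold DF
  simp only [Derivation.add_apply, Derivation.smul_apply, DerX1, DerX2, pb, pd, e]
  fin_cases i <;> simp <;> grind

lemma DHX (i : Fin 4) : DH (X i) =
    (![-ci * X 1, ci * X 0, ci * X 3, -ci * X 2] : Fin 4 → Pol) i := by
  have := ci2
  have := ch2
  have e : ∀ x : Pol, (2 * Complex.I) • x = 2 * (ci * x) := fun x => by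
    rw [MvPolynomial.smul_eq_C_mul, C_mul, ci, mul_assoc, C2]
  unfold DH
  simp only [Derivation.smul_apply, DerX3, e]
  fin_cases i <;> simp <;> grind

lemma brEF (f : Pol) : DE (DF f) - DF (DE f) = DH f := by
  have h : ⁅DE, DF⁆ = DH := by
    apply derivation_ext
    intro i
    have := ci2
    have := ch2
    rw [Derivation.commutator_apply, DEX, DFX, DHX]
    fin_cases i <;> simp [D_ci, D_ch, pa, pb, pc, pd, DEX, DFX] <;> grind
  rw [← h, Derivation.commutator_apply]

lemma brHF (f : Pol) : DH (DF f) - DF (DH f) = (-2 : ℂ) • DF f := by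
  have h : ⁅DH, DF⁆ = (-2 : ℂ) • DF := by
    apply derivation_ext
    intro i
    have := ci2
    have := ch2
    have e : ∀ x : Pol, (-2 : ℂ) • x = -2 * x := fun x => by
      rw [MvPolynomial.smul_eq_C_mul, C_neg, C2]
    rw [Derivation.commutator_apply, Derivation.smul_apply, DHX, DFX, e]
    fin_cases i <;> simp [D_ci, D_ch, pa, pb, pc, pd, DHX, DFX] <;> grind
  rw [← Derivation.commutator_apply, h, Derivation.smul_apply]

lemma brKF (f : Pol) : DK (DF f) = DF (DK f) := by
  have h : ⁅DK, DF⁆ = 0 := by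
    apply derivation_ext
    intro i
    have := ci2
    have := ch2
    rw [Derivation.commutator_apply, DKX, DFX]
    fin_cases i <;> simp [D_ci, D_ch, pa, pb, pc, pd, DKX, DFX] <;> grind
  rw [← sub_eq_zero, ← Derivation.commutator_apply, h]; rfl

lemma act_a : DE pa = 0 ∧ DH pa = pa ∧ DK pa = pa ∧ DF pa = pb := by
  have := ci2
  have := ch2
  refine ⟨?_, ?_, ?_, ?_⟩ <;> simp [D_ci, D_ch, pa, pb, pc, pd, DEX, DHX, DKX, DFX] <;> grind

lemma act_c : DE pc = 0 ∧ DH pc = pc ∧ DK pc = -pc ∧ DF pc = pd := by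
  have := ci2
  have := ch2
  refine ⟨?_, ?_, ?_, ?_⟩ <;> simp [D_ci, D_ch, pa, pb, pc, pd, DEX, DHX, DKX, DFX] <;> grind

lemma act_bd : DF pb = 0 ∧ DF pd = 0 := by
  have := ci2
  have := ch2
  refine ⟨?_, ?_⟩ <;> simp [D_ci, D_ch, pa, pb, pc, pd, DEX, DHX, DKX, DFX] <;> grind

lemma act_q : DE pq = 0 ∧ DH pq = 0 ∧ DK pq = 0 ∧ DF pq = 0 := by
  have := ci2
  have := ch2
  refine ⟨?_, ?_, ?_, ?_⟩ <;>
    simp [D_ci, D_ch, pa, pb, pc, pd, pq, pow_two, DEX, DHX, DKX, DFX] <;> grind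

lemma pa_ne : pa ≠ 0 := by
  intro h
  have := congrArg (eval ![1, 0, 0, 0]) h
  simp [pa, ci] at this

lemma pc_ne : pc ≠ 0 := by
  intro h
  have := congrArg (eval ![0, 0, 1, 0]) h
  simp [pc, ci] at this

lemma pq_ne : pq ≠ 0 := by
  intro h
  have := congrArg (eval ![0, 0, 1, 0]) h
  simp [pq] at this

lemma pa_hom : pa.IsHomogeneous 1 :=
  (isHomogeneous_X _ _).sub (IsHomogeneous.C_mul (isHomogeneous_X _ _) _)
lemma pc_hom : pc.IsHomogeneous 1 :=
  (isHomogeneous_X _ _).add (IsHomogeneous.C_mul (isHomogeneous_X _ _) _)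
lemma pq_hom : pq.IsHomogeneous 2 :=
  (((isHomogeneous_X_pow _ _).add (isHomogeneous_X_pow _ _)).add
    (isHomogeneous_X_pow _ _)).add (isHomogeneous_X_pow _ _)

/-- highest weight vectors -/
noncomputable def hw (p s t : ℕ) : Pol := pq ^ p * (pa ^ s * pc ^ t)

lemma hw_ne (p s t : ℕ) : hw p s t ≠ 0 :=
  mul_ne_zero (pow_ne_zero _ pq_ne) (mul_ne_zero (pow_ne_zero _ pa_ne) (pow_ne_zero _ pc_ne))

lemma hw_hom (p s t : ℕ) : (hw p s t).IsHomogeneous (2 * p + (s + t)) := by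
  have := (pq_hom.pow p).mul ((pa_hom.pow s).mul (pc_hom.pow t))
  simpa [hw] using this

lemma D_pow (D : Derivation ℂ Pol Pol) (x : Pol) (l : ℂ) (h : D x = l • x) (n : ℕ) :
    D (x ^ n) = (n * l) • x ^ n := by
  induction n with
  | zero => simp
  | succ n ih =>
    rw [pow_succ, D.leibniz, ih, h]
    simp only [smul_eq_mul, mul_smul_comm, push_cast]
    rw [mul_comm x, ← add_smul]; congr 1; ring

lemma D_mul (D : Derivation ℂ Pol Pol) (x y : Pol) (l k : ℂ) (h : D x = l • x) (h' : D y = k • y) :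
    D (x * y) = (l + k) • (x * y) := by
  rw [D.leibniz, h, h']
  simp only [smul_eq_mul, mul_smul_comm]
  rw [mul_comm y, ← add_smul]; congr 1; ring

lemma D_hw (D : Derivation ℂ Pol Pol) (la lc : ℂ) (ha : D pa = la • pa) (hc : D pc = lc • pc)
    (hq : D pq = 0) (p s t : ℕ) : D (hw p s t) = (s * la + t * lc) • hw p s t := by
  have hq' : D pq = (0 : ℂ) • pq := by simp [hq]
  have := D_mul D _ _ _ _ (D_pow D _ _ hq' p) (D_mul D _ _ _ _ (D_pow D _ _ ha s) (D_pow D _ _ hc t))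
  simpa [hw] using this

lemma hw_E (p s t : ℕ) : DE (hw p s t) = 0 := by
  simpa using D_hw DE 0 0 (by simp [act_a]) (by simp [act_c]) act_q.1 p s t
lemma hw_H (p s t : ℕ) : DH (hw p s t) = ((s + t : ℕ) : ℂ) • hw p s t := by
  simpa using D_hw DH 1 1 (by simp [act_a]) (by simp [act_c]) act_q.2.1 p s t
lemma hw_K (p s t : ℕ) : DK (hw p s t) = ((s : ℂ) - t) • hw p s t := by
  simpa [sub_eq_add_neg] using D_hw DK 1 (-1) (by simp [act_a]) (by simp [act_c]) act_q.2.2.1 p s t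

lemma iter_zero (D : Derivation ℂ Pol Pol) (n : ℕ) : D^[n] 0 = 0 := by
  induction n with
  | zero => rfl
  | succ n ih => rw [Function.iterate_succ_apply, map_zero, ih]

lemma iter_add (D : Derivation ℂ Pol Pol) (n : ℕ) (x y : Pol) : D^[n] (x + y) = D^[n] x + D^[n] y := by
  induction n generalizing x y with
  | zero => rfl
  | succ n ih => rw [Function.iterate_succ_apply, map_add, ih]; rfl

lemma nil_mul (D : Derivation ℂ Pol Pol) (n : ℕ) : ∀ (k l : ℕ) (x y : Pol), k + l = n →
    D^[k+1] x = 0 → D^[l+1] y = 0 → D^[n+1] (x * y) = 0 := by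
  induction n with
  | zero =>
    intro k l x y h hx hy
    obtain ⟨rfl, rfl⟩ : k = 0 ∧ l = 0 := by omega
    simp at hx hy
    simp [D.leibniz, hx, hy]
  | succ n ih =>
    intro k l x y h hx hy
    rw [Function.iterate_succ_apply, D.leibniz, iter_add, smul_eq_mul, smul_eq_mul]
    have h1 : D^[n+1] (x * D y) = 0 := by
      rcases l with _ | l
      · have : D y = 0 := hy
        rw [this, mul_zero, iter_zero]
      · exact ih k l _ _ (by omega) hx hy
    have h2 : D^[n+1] (y * D x) = 0 := by
      rcases k with _ | k
      · have : D x = 0 := hx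
        rw [this, mul_zero, iter_zero]
      · exact ih l k _ _ (by omega) hy hx
    rw [h1, h2, add_zero]

lemma nil_pow (D : Derivation ℂ Pol Pol) (k : ℕ) (x : Pol) (hx : D^[k+1] x = 0) (n : ℕ) :
    D^[k * n + 1] (x ^ n) = 0 := by
  induction n with
  | zero => simp
  | succ n ih => rw [pow_succ]; exact nil_mul D _ (k * n) k _ _ rfl ih hx

lemma hw_nil (p s t : ℕ) : DF^[s + t + 1] (hw p s t) = 0 := by
  have h := nil_mul DF _ _ _ _ _ rfl (nil_pow DF 0 pq act_q.2.2.2 p)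
    (nil_mul DF _ _ _ _ _ rfl (nil_pow DF 1 pa (by simp [act_a, act_bd]) s)
      (nil_pow DF 1 pc (by simp [act_c, act_bd]) t))
  simpa [hw] using h

/-- weight vectors -/
noncomputable def wv (p r j i : ℕ) : Pol := DF^[i] (hw p (r - j) j)

lemma wv_F (p r j i : ℕ) : DF (wv p r j i) = wv p r j (i + 1) :=
  (Function.iterate_succ_apply' _ _ _).symm

lemma wv_top (p r j : ℕ) (hj : j ≤ r) : wv p r j (r + 1) = 0 := by
  have := hw_nil p (r - j) j
  rwa [Nat.sub_add_cancel hj] at this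

lemma wv_H (p r j i : ℕ) (hj : j ≤ r) : DH (wv p r j i) = ((r : ℂ) - 2 * i) • wv p r j i := by
  induction i with
  | zero =>
    have := hw_H p (r - j) j
    rw [Nat.sub_add_cancel hj] at this
    simpa [wv] using this
  | succ i ih =>
    rw [← wv_F, sub_eq_iff_eq_add.1 (brHF _), ih, Derivation.map_smul]
    push_cast; module

lemma wv_K (p r j i : ℕ) (hj : j ≤ r) : DK (wv p r j i) = ((r : ℂ) - 2 * j) • wv p r j i := by
  induction i with
  | zero =>
    have := hw_K p (r - j) j
    rw [wv, Function.iterate_zero, id, this, Nat.cast_sub hj]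
    congr 1; ring
  | succ i ih =>
    rw [← wv_F, brKF, ih, Derivation.map_smul]

lemma wv_E0 (p r j : ℕ) : DE (wv p r j 0) = 0 := hw_E _ _ _

lemma wv_E (p r j i : ℕ) (hj : j ≤ r) :
    DE (wv p r j (i + 1)) = (((i : ℂ) + 1) * (r - i)) • wv p r j i := by
  induction i with
  | zero =>
    rw [← wv_F, sub_eq_iff_eq_add.1 (brEF _), wv_E0, wv_H _ _ _ _ hj]; simp
  | succ i ih =>
    rw [← wv_F, sub_eq_iff_eq_add.1 (brEF _), ih, wv_H _ _ _ _ hj, Derivation.map_smul, wv_F]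
    push_cast; module

lemma wv_ne (p r j i : ℕ) (hj : j ≤ r) (hi : i ≤ r) : wv p r j i ≠ 0 := by
  induction i with
  | zero => exact hw_ne _ _ _
  | succ i ih =>
    intro h
    have := wv_E p r j i hj
    rw [h, map_zero] at this
    have h1 : ((i : ℂ) + 1) ≠ 0 := by exact_mod_cast Nat.succ_ne_zero i
    have h2 : ((r : ℂ) - i) ≠ 0 := by
      rw [sub_ne_zero]; exact_mod_cast (by omega : r ≠ i)
    exact smul_ne_zero (mul_ne_zero h1 h2) (ih (by omega)) this.symm

/-- Separating operator -/
noncomputable def TT (N : ℂ) : Module.End ℂ Pol :=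
  (N ^ 2) • ((4 : ℂ) • (DF.toLinearMap ∘ₗ DE.toLinearMap) + DH.toLinearMap ∘ₗ DH.toLinearMap
    + (2 : ℂ) • DH.toLinearMap) + N • DH.toLinearMap + DK.toLinearMap

lemma TT_wv (N : ℂ) (p r j i : ℕ) (hj : j ≤ r) : TT N (wv p r j i) =
    (N ^ 2 * (r * (r + 2)) + N * (r - 2 * i) + (r - 2 * j)) • wv p r j i := by
  have hFE : DF (DE (wv p r j i)) = ((i : ℂ) * (r - i + 1)) • wv p r j i := by
    rcases i with _ | i
    · rw [wv_E0]; simp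
    · rw [wv_E _ _ _ _ hj, Derivation.map_smul, wv_F]; push_cast; congr 1; ring
  simp only [TT, LinearMap.add_apply, LinearMap.smul_apply, LinearMap.comp_apply,
    Derivation.coeFn_coe, hFE, wv_H _ _ _ _ hj, wv_K _ _ _ _ hj,
    Derivation.map_smul]
  module

end SU2Aux
namespace SU2Aux
open MvPolynomial

lemma sum_ext0 (r : ℕ) (v : Fin (r + 1) → ℂ) (w : ℕ → Pol) :
    ∑ i : Fin (r + 1), v i • w i = ∑ k ∈ Finset.range (r + 1), ext0 v k • w k := by
  rw [Finset.sum_range]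
  simp only [ext0_coe]

/-- the string attached to a highest weight vector -/
noncomputable def Gs (p r j : ℕ) : (Fin (r + 1) → ℂ) →ₗ[ℂ] Pol :=
  Fintype.linearCombination ℂ (fun i : Fin (r + 1) => wv p r j i)

lemma Gs_apply (p r j : ℕ) (v : Fin (r + 1) → ℂ) :
    Gs p r j v = ∑ k ∈ Finset.range (r + 1), ext0 v k • wv p r j k := by
  rw [← sum_ext0 r v (fun k => wv p r j k)]; rfl

lemma Gs_F (p r j : ℕ) (hj : j ≤ r) (v : Fin (r + 1) → ℂ) :
    DF (Gs p r j v) = Gs p r j ((Fm r).mulVec v) := by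
  rw [Gs_apply, Gs_apply, map_sum]
  simp only [Derivation.map_smul, wv_F]
  rw [Finset.sum_range_succ, wv_top _ _ _ hj, Finset.sum_range_succ', Fm_mulVec_zero]
  simp only [smul_zero, zero_smul, add_zero]
  refine Finset.sum_congr rfl fun k hk => ?_
  rw [Fm_mulVec _ _ _ (by simpa using hk)]

lemma Gs_E (p r j : ℕ) (hj : j ≤ r) (v : Fin (r + 1) → ℂ) :
    DE (Gs p r j v) = Gs p r j ((Em r).mulVec v) := by
  rw [Gs_apply, Gs_apply, map_sum]
  simp only [Derivation.map_smul, Em_mulVec]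
  rw [Finset.sum_range_succ', Finset.sum_range_succ, wv_E0]
  simp only [sub_self, mul_zero, zero_mul, smul_zero, zero_smul, add_zero]
  refine Finset.sum_congr rfl fun k hk => ?_
  rw [wv_E _ _ _ _ hj, smul_smul, mul_comm]

lemma Gs_H (p r j : ℕ) (hj : j ≤ r) (v : Fin (r + 1) → ℂ) :
    DH (Gs p r j v) = Gs p r j ((Hm r).mulVec v) := by
  rw [Gs_apply, Gs_apply, map_sum]
  refine Finset.sum_congr rfl fun k hk => ?_
  rw [Derivation.map_smul, Hm_mulVec, wv_H _ _ _ _ hj, smul_smul, mul_comm]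

lemma Gs_X (p r j : ℕ) (hj : j ≤ r) (v : Fin (r + 1) → ℂ) :
    Der R1 (Gs p r j v) = Gs p r j ((Xm r).mulVec v) := by
  have hI := Complex.I_mul_I
  rw [Xm, Matrix.smul_mulVec, Matrix.add_mulVec, map_smul, map_add, ← Gs_E _ _ _ hj,
    ← Gs_F _ _ _ hj]
  simp only [DE, DF, Derivation.add_apply, Derivation.sub_apply, Derivation.smul_apply]
  match_scalars <;> grind

lemma Gs_Y (p r j : ℕ) (hj : j ≤ r) (v : Fin (r + 1) → ℂ) :
    Der R2 (Gs p r j v) = Gs p r j ((Ym r).mulVec v) := by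
  rw [Ym, Matrix.smul_mulVec, Matrix.sub_mulVec, map_smul, map_sub, ← Gs_E _ _ _ hj,
    ← Gs_F _ _ _ hj]
  simp only [DE, DF, Derivation.add_apply, Derivation.sub_apply, Derivation.smul_apply]
  module

lemma Gs_Z (p r j : ℕ) (hj : j ≤ r) (v : Fin (r + 1) → ℂ) :
    Der R3 (Gs p r j v) = Gs p r j ((Zm r).mulVec v) := by
  have hI := Complex.I_mul_I
  rw [Zm, Matrix.smul_mulVec, map_smul, ← Gs_H _ _ _ hj]
  simp only [DH, Derivation.smul_apply]
  match_scalars <;> grind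

abbrev Tgt (m : ℕ) := (p : Fin (m / 2 + 1)) →
            Fin (m - 2 * (p : ℕ) + 1) → Fin (m - 2 * (p : ℕ) + 1) → ℂ

noncomputable def GG (m : ℕ) : Tgt m →ₗ[ℂ] Pol :=
  ∑ p : Fin (m / 2 + 1), ∑ c : Fin (m - 2 * (p : ℕ) + 1),
    Gs p (m - 2 * (p : ℕ)) c ∘ₗ LinearMap.proj c ∘ₗ LinearMap.proj p

lemma GG_apply (m : ℕ) (y : Tgt m) : GG m y =
    ∑ p : Fin (m / 2 + 1), ∑ c : Fin (m - 2 * (p : ℕ) + 1), Gs p (m - 2 * (p : ℕ)) c (y p c) := by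
  simp [GG]

abbrev Idx (m : ℕ) := Σ p : Fin (m / 2 + 1), Fin (m - 2 * (p : ℕ) + 1) × Fin (m - 2 * (p : ℕ) + 1)

lemma arith (m r i j r' i' j' : ℤ) (hr : 0 ≤ r) (hrm : r ≤ m) (hr' : 0 ≤ r') (hrm' : r' ≤ m)
    (hi : 0 ≤ i) (hir : i ≤ r) (hj : 0 ≤ j) (hjr : j ≤ r)
    (hi' : 0 ≤ i') (hir' : i' ≤ r') (hj' : 0 ≤ j') (hjr' : j' ≤ r')
    (h : (2 * m + 2) ^ 2 * (r * (r + 2)) + (2 * m + 2) * (r - 2 * i) + (r - 2 * j) =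
      (2 * m + 2) ^ 2 * (r' * (r' + 2)) + (2 * m + 2) * (r' - 2 * i') + (r' - 2 * j')) :
    r = r' ∧ i = i' ∧ j = j' := by
  have h1 : (r - 2 * j) - (r' - 2 * j') = 0 := by
    apply Int.eq_zero_of_abs_lt_dvd (m := 2 * m + 2)
    · exact ⟨(2 * m + 2) * (r' * (r' + 2) - r * (r + 2)) + ((r' - 2 * i') - (r - 2 * i)),
        by linear_combination h⟩
    · rw [abs_lt]; constructor <;> linarith
  have hN : (2 * m + 2) ≠ 0 := by omega
  have h2' : (2 * m + 2) * (r * (r + 2)) + (r - 2 * i) =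
      (2 * m + 2) * (r' * (r' + 2)) + (r' - 2 * i') := by
    apply mul_left_cancel₀ hN
    linear_combination h - h1
  have h2 : (r - 2 * i) - (r' - 2 * i') = 0 := by
    apply Int.eq_zero_of_abs_lt_dvd (m := 2 * m + 2)
    · exact ⟨r' * (r' + 2) - r * (r + 2), by linear_combination h2'⟩
    · rw [abs_lt]; constructor <;> linarith
  have h3 : r * (r + 2) = r' * (r' + 2) := by
    apply mul_left_cancel₀ hN
    linear_combination h2' - h2
  have h4 : (r - r') * (r + r' + 2) = 0 := by linear_combination h3
  have h5 : r = r' := by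
    rcases mul_eq_zero.1 h4 with h | h <;> omega
  omega

lemma linInd (m : ℕ) : LinearIndependent ℂ
    (fun x : Idx m => wv x.1 (m - 2 * (x.1 : ℕ)) x.2.1 x.2.2) := by
  refine Module.End.eigenvectors_linearIndependent' (TT (2 * m + 2))
    (fun x : Idx m => ((2 * m + 2) ^ 2 * (((m - 2 * (x.1 : ℕ) : ℕ) : ℂ) * ((m - 2 * (x.1 : ℕ) : ℕ) + 2))
      + (2 * m + 2) * ((m - 2 * (x.1 : ℕ) : ℕ) - 2 * ((x.2.2 : ℕ) : ℂ)) +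
      ((m - 2 * (x.1 : ℕ) : ℕ) - 2 * ((x.2.1 : ℕ) : ℂ)))) ?_ _ ?_
  · rintro ⟨p, j, i⟩ ⟨p', j', i'⟩ h
    simp only at h
    have h' := arith m (m - 2 * (p : ℕ) : ℕ) i j (m - 2 * (p' : ℕ) : ℕ) i' j'
      (by omega) (by omega) (by omega) (by omega) (by omega) (by omega) (by omega) (by omega)
      (by omega) (by omega) (by omega) (by omega) (by exact_mod_cast h)
    have hp : p = p' := by
      have := h'.1
      have h1 := p.2
      have h2 := p'.2
      apply Fin.ext
      omega
    subst hp
    have hi : i = i' := by apply Fin.ext; omega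
    have hj : j = j' := by apply Fin.ext; omega
    subst hi hj
    rfl
  · rintro ⟨p, j, i⟩
    refine ⟨?_, wv_ne _ _ _ _ (by have := j.2; simp only; omega) (by have := i.2; simp only; omega)⟩
    rw [Module.End.mem_eigenspace_iff]
    exact TT_wv _ _ _ _ _ (by omega)

lemma GG_inj (m : ℕ) : Function.Injective (GG m) := by
  rw [injective_iff_map_eq_zero]
  intro y hy
  have h := (Fintype.linearIndependent_iff.1 (linInd m)) (fun x => y x.1 x.2.1 x.2.2) (by
    rw [Fintype.sum_sigma]
    rw [← hy, GG_apply]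
    refine Finset.sum_congr rfl fun p _ => ?_
    rw [Fintype.sum_prod_type]
    rfl)
  funext p c i
  exact h ⟨p, c, i⟩

lemma wv_range (m p j i : ℕ) (hp : 2 * p ≤ m) (hj : j ≤ m - 2 * p) :
    wv p (m - 2 * p) j i ∈ LinearMap.range (Phi m) := by
  induction i with
  | zero =>
    apply Phi_surj
    have := hw_hom p (m - 2 * p - j) j
    rwa [Nat.sub_add_cancel hj, Nat.add_sub_cancel' hp] at this
  | succ i ih =>
    obtain ⟨v, hv⟩ := ih
    rw [← wv_F, ← hv, DF, Derivation.add_apply, Derivation.smul_apply, ← Phi_act, ← Phi_act]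
    exact ⟨Complex.I • (symMatActC m R1).mulVec v + (symMatActC m R2).mulVec v, by simp⟩

lemma GG_range (m : ℕ) (y : Tgt m) : GG m y ∈ LinearMap.range (Phi m) := by
  rw [GG_apply]
  refine Submodule.sum_mem _ fun p _ => Submodule.sum_mem _ fun c _ => ?_
  rw [Gs_apply]
  refine Submodule.sum_mem _ fun k _ => Submodule.smul_mem _ _ (wv_range _ _ _ _ ?_ ?_)
  · have := p.2; omega
  · have := c.2; omega

noncomputable def GS (m : ℕ) : Tgt m →ₗ[ℂ] (Sym (Fin 4) m → ℂ) :=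
  (LinearEquiv.ofInjective (Phi m) (Phi_inj m)).symm.toLinearMap ∘ₗ
    (GG m).codRestrict _ (GG_range m)

lemma Phi_GS (m : ℕ) (y : Tgt m) : Phi m (GS m y) = GG m y := by
  have := (LinearEquiv.ofInjective (Phi m) (Phi_inj m)).apply_symm_apply
    ((GG m).codRestrict _ (GG_range m) y)
  exact congrArg Subtype.val this

lemma GS_inj (m : ℕ) : Function.Injective (GS m) := by
  intro x y h
  apply GG_inj
  rw [← Phi_GS, h, Phi_GS]

lemma choose_sq (n : ℕ) : n.choose 2 + (n + 1).choose 2 = n ^ 2 := by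
  induction n with
  | zero => rfl
  | succ n ih =>
    have h1 := Nat.choose_succ_succ' n 1
    have h2 := Nat.choose_succ_succ' (n + 1) 1
    simp only [Nat.choose_one_right, Nat.reduceAdd] at h1 h2
    nlinarith

lemma sum_sq (m : ℕ) : ∑ p ∈ Finset.range (m / 2 + 1), (m - 2 * p + 1) * (m - 2 * p + 1) =
    (m + 3).choose 3 := by
  induction m using Nat.twoStepInduction with
  | zero => rfl
  | one => rfl
  | more m ih _ =>
    have e : (m + 2) / 2 = m / 2 + 1 := by omega
    rw [e, Finset.sum_range_succ']
    have : ∀ p, m + 2 - 2 * (p + 1) + 1 = m - 2 * p + 1 := by intro p; omega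
    simp only [this, ih]
    have h1 := Nat.choose_succ_succ' (m + 3) 2
    have h2 := Nat.choose_succ_succ' (m + 4) 2
    have h3 := choose_sq (m + 3)
    simp only [Nat.reduceAdd, add_assoc] at h1 h2 h3
    simp only [Nat.mul_zero, Nat.sub_zero, add_assoc, Nat.reduceAdd]
    nlinarith

lemma dim_eq (m : ℕ) : Module.finrank ℂ (Tgt m) = Module.finrank ℂ (Sym (Fin 4) m → ℂ) := by
  rw [Module.finrank_fintype_fun_eq_card, Sym.card_sym_eq_choose, Module.finrank_pi_fintype]
  simp only [Module.finrank_pi_fintype, Module.finrank_self, Finset.sum_const, Finset.card_univ,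
    Fintype.card_fin, smul_eq_mul, mul_one]
  rw [Finset.sum_range (fun p => (m - 2 * p + 1) * (m - 2 * p + 1)) |>.symm, sum_sq]
  have : 4 + m - 1 = m + 3 := by omega
  rw [this, Nat.choose_symm_add]

lemma intertwine (m : ℕ) (L : Matrix (Fin 4) (Fin 4) ℝ)
    (M : (r : ℕ) → Matrix (Fin (r + 1)) (Fin (r + 1)) ℂ)
    (h : ∀ p r j : ℕ, j ≤ r → ∀ v : Fin (r + 1) → ℂ,
      Der L (Gs p r j v) = Gs p r j ((M r).mulVec v))
    (e : Tgt m ≃ₗ[ℂ] (Sym (Fin 4) m → ℂ)) (he : ∀ y, e y = GS m y) (v : Sym (Fin 4) m → ℂ) :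
    e.symm ((symMatActC m L).mulVec v) =
      fun (p : Fin (m / 2 + 1)) c => (M (m - 2 * (p : ℕ))).mulVec (e.symm v p c) := by
  rw [LinearEquiv.symm_apply_eq, he]
  apply Phi_inj
  rw [Phi_act, Phi_GS, GG_apply]
  have hv : v = GS m (e.symm v) := by rw [← he, LinearEquiv.apply_symm_apply]
  conv_lhs => rw [hv, Phi_GS, GG_apply, map_sum]
  refine Finset.sum_congr rfl fun p _ => ?_
  rw [map_sum]
  exact Finset.sum_congr rfl fun c _ => h _ _ _ (by have := c.2; omega) _

end SU2Aux

/-- `S^m_ℝ(ℂ²) ⊗ ℂ ≅ ⊕_{p=0}^{⌊m/2⌋} (m−2p+1) · Vℂ_{m−2p}` as complex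
`SU(2)`-representations: the complexified space of degree-`m` homogeneous real
polynomials on `ℂ²` decomposes into `m−2p+1` copies of the irreducible complex
representation of dimension `m−2p+1`, for `p = 0, …, ⌊m/2⌋`. -/
theorem sym_power_real_polys_complexified (m : ℕ) :
    ∃ (X Y Z : (p : Fin (m / 2 + 1)) →
        Matrix (Fin (m - 2 * (p : ℕ) + 1)) (Fin (m - 2 * (p : ℕ) + 1)) ℂ),
      (∀ p, IsSU2RepC (X p) (Y p) (Z p) ∧ IsIrredRepC (X p) (Y p) (Z p)) ∧
      ∃ e : (Sym (Fin 4) m → ℂ) ≃ₗ[ℂ]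
          ((p : Fin (m / 2 + 1)) →
            Fin (m - 2 * (p : ℕ) + 1) → Fin (m - 2 * (p : ℕ) + 1) → ℂ),
        (∀ v, e ((symMatActC m R1).mulVec v) = fun p c => (X p).mulVec (e v p c)) ∧
        (∀ v, e ((symMatActC m R2).mulVec v) = fun p c => (Y p).mulVec (e v p c)) ∧
        (∀ v, e ((symMatActC m R3).mulVec v) = fun p c => (Z p).mulVec (e v p c)) := by
  classical
  refine ⟨fun p => SU2Aux.Xm _, fun p => SU2Aux.Ym _, fun p => SU2Aux.Zm _,
    fun p => ⟨SU2Aux.isRep _, SU2Aux.isIrred _⟩, ?_⟩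
  let e := LinearEquiv.ofInjectiveOfFinrankEq (SU2Aux.GS m) (SU2Aux.GS_inj m) (SU2Aux.dim_eq m)
  have he : ∀ y, e y = SU2Aux.GS m y := fun y => rfl
  exact ⟨e.symm, SU2Aux.intertwine m _ _ SU2Aux.Gs_X e he,
    SU2Aux.intertwine m _ _ SU2Aux.Gs_Y e he, SU2Aux.intertwine m _ _ SU2Aux.Gs_Z e he⟩
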